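/- Let Ω ⊆ ℝ^d be open. If y belongs to the closure of V(Ω) but y ∉ V(Ω), then there is an index j with y_j = 0. Equivalently, every point of the closure of V(Ω) all of whose coordinates are nonzero lies in V(Ω). -/

import Mathlib

/-- `V(Ω) = {η : ∀ x ∈ Ω, η * x ∈ Ω}` (coordinatewise product). -/
def Vset {d : ℕ} (Ω : Set (Fin d → ℝ)) : Set (Fin d → ℝ) :=
  {η | ∀ x ∈ Ω, η * x ∈ Ω}

open Filter Topology in
/-- For open `Ω`, a point of `closure (V(Ω))` without vanishing coordinates lies in `V(Ω)`. -/
theorem mem_Vset_of_mem_closure {d : ℕ} {Ω : Set (Fin d → ℝ)} (hΩ : IsOpen Ω) {y : Fin d → ℝ}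
    (hy : y ∈ closure (Vset Ω)) (h0 : ∀ j, y j ≠ 0) : y ∈ Vset Ω := by
  intro x hx
  have hlim : Tendsto (fun η : Fin d → ℝ => y * x / η) (𝓝 y) (𝓝 x) := by
    refine tendsto_pi_nhds.2 fun j => ?_
    have h := (tendsto_const_nhds (x := y j * x j)).div
      ((continuous_apply j).tendsto y) (h0 j)
    rwa [mul_div_cancel_left₀ _ (h0 j)] at h
  have hne : ∀ᶠ η in 𝓝 y, ∀ j, η j ≠ 0 :=
    eventually_all.2 fun j => ((continuous_apply j).tendsto y).eventually_ne (h0 j)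
  obtain ⟨η, hη, hmem, hη0⟩ := ((mem_closure_iff_frequently.1 hy).and_eventually
    ((hlim.eventually_mem (hΩ.mem_nhds hx)).and hne)).exists
  have heq : η * (y * x / η) = y * x := funext fun j => mul_div_cancel₀ _ (hη0 j)
  exact heq ▸ hη _ hmem

/-- If `Ω ⊆ ℝ^d` is open and `y ∈ closure (V(Ω)) \ V(Ω)`, then some coordinate of `y`
vanishes; equivalently, every point of `closure (V(Ω))` with all coordinates nonzero
lies in `V(Ω)`. -/
theorem stmt6 {d : ℕ} (hd : 0 < d) (Ω : Set (Fin d → ℝ)) (hΩ : IsOpen Ω) :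
    (∀ y ∈ closure (Vset Ω) \ Vset Ω, ∃ j, y j = 0) ∧
    (∀ y ∈ closure (Vset Ω), (∀ j, y j ≠ 0) → y ∈ Vset Ω) := by
  refine ⟨fun y hy => ?_, fun y hy h0 => mem_Vset_of_mem_closure hΩ hy h0⟩
  by_contra! h0
  exact hy.2 (mem_Vset_of_mem_closure hΩ hy.1 h0)
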